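/- arXiv:math/0212049 — 3 statements merged into one kernel-verified Lean document; each statement's English description precedes it below -/
import Mathlib

section
/- Let c : Ordinal → ℕ → Bool assign to every ordinal a tape (an assignment of a Boolean value to each cell n ∈ ℕ). Then there exists an ordinal α₀ < ω₁ such that every cell that stabilizes before ω₁ has stabilized by α₀: for every n ∈ ℕ, if there exists β < ω₁ such that c γ n = c β n for all γ with β ≤ γ < ω₁, then c γ n = c α₀ n for all γ with α₀ ≤ γ < ω₁. -/
/-- The first uncountable ordinal ω₁. -/
noncomputable def omega1 : Ordinal := (Cardinal.aleph 1).ord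

/-- There is a countable ordinal `α₀` by which time all of the cells that have
stabilized by `ω₁` have stabilized. -/
theorem exists_stabilization_stage (c : Ordinal → ℕ → Bool) :
    ∃ α₀ : Ordinal, α₀ < omega1 ∧
      ∀ n : ℕ,
        (∃ β < omega1, ∀ γ : Ordinal, β ≤ γ → γ < omega1 → c γ n = c β n) →
        ∀ γ : Ordinal, α₀ ≤ γ → γ < omega1 → c γ n = c α₀ n := by
  have omega1_eq : omega1 = Ordinal.omega 1 := Cardinal.ord_aleph 1
  let S : Set ℕ := {n | ∃ β < omega1, ∀ γ : Ordinal, β ≤ γ → γ < omega1 → c γ n = c β n}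
  choose b hb_lt hb using fun n : S => n.2
  have hsup : ⨆ n, b n < omega1 := by
    rw [omega1_eq]
    exact Ordinal.iSup_lt_omega_one fun n => omega1_eq ▸ hb_lt n
  refine ⟨⨆ n, b n, hsup, fun n hn γ hγ hγ_lt => ?_⟩
  have hle : b ⟨n, hn⟩ ≤ ⨆ n, b n := Ordinal.le_iSup b ⟨n, hn⟩
  exact (hb ⟨n, hn⟩ γ (hle.trans hγ) hγ_lt).trans (hb ⟨n, hn⟩ _ hle hsup).symm
end

section
/- Let c : Ordinal → ℕ → Bool assign to every ordinal a tape (an assignment of a Boolean value to each cell n ∈ ℕ), and let α₀ < ω₁. Then there exists a strictly increasing sequence α : ℕ → Ordinal with α 0 = α₀ and α n < ω₁ for every n, such that for every n ∈ ℕ and every cell m ∈ ℕ: if cell m changes its value at some pair of stages in [α n, ω₁) (that is, there exist γ, γ' with α n ≤ γ < γ' < ω₁ and c γ m ≠ c γ' m), then cell m already changes its value at some pair of stages in [α n, α (n+1)) (there exist γ, γ' with α n ≤ γ < γ' < α (n+1) and c γ m ≠ c γ' m). -/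
theorem omega1_eq_omega_one : omega1 = Ordinal.omega 1 :=
  Cardinal.ord_aleph 1

/-- A countable family of countable ordinals is strictly bounded by a countable ordinal. -/
theorem exists_forall_lt_of_forall_lt_omega1 (f : ℕ → Ordinal) (hf : ∀ m, f m < omega1) :
    ∃ β < omega1, ∀ m, f m < β := by
  rw [omega1_eq_omega_one] at *
  refine ⟨Order.succ (⨆ m, f m), ?_, fun m => Order.lt_succ_of_le (Ordinal.le_iSup f m)⟩
  exact (Cardinal.isSuccLimit_omega 1).succ_lt (Ordinal.iSup_lt_omega_one hf)

/-- Beyond any countable stage there is a countable stage before which every cell that changes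
its value from then on has already done so. -/
theorem exists_change_capturing_stage (c : Ordinal → ℕ → Bool) (α : Ordinal)
    (hα : α < omega1) :
    ∃ β, α < β ∧ β < omega1 ∧ ∀ m : ℕ,
      (∃ γ γ' : Ordinal, α ≤ γ ∧ γ < γ' ∧ γ' < omega1 ∧ c γ m ≠ c γ' m) →
      (∃ γ γ' : Ordinal, α ≤ γ ∧ γ < γ' ∧ γ' < β ∧ c γ m ≠ c γ' m) := by
  have h : ∀ m : ℕ, ∃ δ < omega1, α ≤ δ ∧
      ((∃ γ γ' : Ordinal, α ≤ γ ∧ γ < γ' ∧ γ' < omega1 ∧ c γ m ≠ c γ' m) →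
        ∃ γ, α ≤ γ ∧ γ < δ ∧ c γ m ≠ c δ m) := by
    intro m
    by_cases hm : ∃ γ γ' : Ordinal, α ≤ γ ∧ γ < γ' ∧ γ' < omega1 ∧ c γ m ≠ c γ' m
    · obtain ⟨γ, γ', hγ, hlt, hγ', hne⟩ := hm
      exact ⟨γ', hγ', hγ.trans hlt.le, fun _ => ⟨γ, hγ, hlt, hne⟩⟩
    · exact ⟨α, hα, le_rfl, fun h => absurd h hm⟩
  choose δ hδ hαδ hchange using h
  obtain ⟨β, hβ, hδβ⟩ := exists_forall_lt_of_forall_lt_omega1 δ hδ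
  refine ⟨β, (hαδ 0).trans_lt (hδβ 0), hβ, fun m hm => ?_⟩
  obtain ⟨γ, hγ, hlt, hne⟩ := hchange m hm
  exact ⟨γ, δ m, hγ, hlt, hδβ m, hne⟩

/-- There is a countable strictly increasing sequence of countable ordinals
`α 0 = α₀ < α 1 < ⋯` such that every cell that changes its value at some pair of
stages in `[α n, ω₁)` already changes its value at some pair of stages in
`[α n, α (n+1))`. -/
theorem exists_change_capturing_sequence (c : Ordinal → ℕ → Bool)
    (α₀ : Ordinal) (hα₀ : α₀ < omega1) :
    ∃ α : ℕ → Ordinal, StrictMono α ∧ α 0 = α₀ ∧ (∀ n : ℕ, α n < omega1) ∧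
      ∀ n m : ℕ,
        (∃ γ γ' : Ordinal, α n ≤ γ ∧ γ < γ' ∧ γ' < omega1 ∧ c γ m ≠ c γ' m) →
        (∃ γ γ' : Ordinal, α n ≤ γ ∧ γ < γ' ∧ γ' < α (n + 1) ∧ c γ m ≠ c γ' m) := by
  choose next hlt hnext hcapture using exists_change_capturing_stage c
  let s : ℕ → {α : Ordinal // α < omega1} :=
    fun n => Nat.rec ⟨α₀, hα₀⟩ (fun _ a => ⟨next a.1 a.2, hnext a.1 a.2⟩) n
  exact ⟨fun n => (s n).1, strictMono_nat_of_lt_succ fun n => hlt (s n).1 (s n).2, rfl,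
    fun n => (s n).2, fun n m => hcapture (s n).1 (s n).2 m⟩
end

section
/- Define H : ℕ → Set ℕ by H n = {m : ℕ | n < m ∧ (Odd m ∨ m ≤ 4 * n)} (the set of bills you hold after n transactions with the Devil). Then: (i) H 0 is exactly the set of odd natural numbers; (ii) for every n, the least element of H n is n + 1, and H (n + 1) = (H n \ {n + 1}) ∪ {4 * n + 2, 4 * n + 4}, so at each transaction the Devil takes your lowest-numbered bill and pays you two higher-numbered bills; (iii) every H n is infinite; and yet (iv) no bill remains in your possession in the limit: for every m ≥ 1 and every n ≥ m, m ∉ H n, and consequently ⋃ (N : ℕ), ⋂ (n : ℕ) (_ : N ≤ n), H n = ∅. -/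
/-- The set of bills you hold after `n` transactions with the Devil: you hold the
bill numbered `m` exactly when `n < m` and `m` is odd or `m ≤ 4 * n`. -/
def DevilHold (n : ℕ) : Set ℕ := {m : ℕ | n < m ∧ (Odd m ∨ m ≤ 4 * n)}

/-- The Devil's exchange: you begin holding the odd-numbered bills; at the `n`-th
transaction the Devil takes your lowest-numbered bill `n + 1` and pays you the two
higher-numbered bills `4 * n + 2` and `4 * n + 4`; at every stage you hold
infinitely many bills; and yet in the limit you hold no bill at all. -/
theorem devil_exchange :
    (DevilHold 0 = {m : ℕ | Odd m}) ∧
    (∀ n : ℕ, IsLeast (DevilHold n) (n + 1) ∧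
      DevilHold (n + 1) = (DevilHold n \ {n + 1}) ∪ {4 * n + 2, 4 * n + 4}) ∧
    (∀ n : ℕ, (DevilHold n).Infinite) ∧
    (∀ m : ℕ, 1 ≤ m → ∀ n : ℕ, m ≤ n → m ∉ DevilHold n) ∧
    (⋃ N : ℕ, ⋂ n : ℕ, ⋂ (_ : N ≤ n), DevilHold n) = ∅ := by
  refine ⟨?_, fun n => ⟨⟨?_, fun m hm => hm.1⟩, ?_⟩, fun n => ?_, fun m _ n hmn hm => ?_, ?_⟩
  · ext m
    simp only [DevilHold, Set.mem_ofPred_eq, Nat.odd_iff]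
    omega
  · simp only [DevilHold, Set.mem_ofPred_eq, Nat.odd_iff]
    omega
  · ext m
    simp only [DevilHold, Set.mem_ofPred_eq, Set.mem_union, Set.mem_sdiff, Set.mem_insert_iff,
      Set.mem_singleton_iff, Nat.odd_iff]
    omega
  · refine Set.infinite_of_not_bddAbove fun ⟨b, hb⟩ => ?_
    have hmem : 2 * (n + b) + 1 ∈ DevilHold n := ⟨by omega, Or.inl ⟨n + b, rfl⟩⟩
    have := hb hmem
    omega
  · exact absurd hm.1 (not_lt.mpr hmn)
  · refine Set.eq_empty_of_forall_notMem fun m hm => ?_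
    simp only [Set.mem_iUnion, Set.mem_iInter] at hm
    obtain ⟨N, hN⟩ := hm
    exact absurd (hN (max N m) (le_max_left N m)).1 (not_lt.mpr (le_max_right N m))
end
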